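/- Let p be a Wolstenholme prime. Then C(2p-1, p-1) ≡ 1 - p³·B_{p⁴-p³-2} - (3/2)·p⁵·B_{p²-p-4} + (3/10)·p⁶·B_{p-5} (mod p⁷). -/

import Mathlib

/-- `a ≡ b (mod p^n)` in the `p`-adic sense for rationals. -/
def PadicCong (p : ℕ) (n : ℕ) (a b : ℚ) : Prop :=
  padicNorm p (a - b) ≤ (p : ℚ) ^ (-(n : ℤ))

/-- `PadicDvd p n x` says that the rational number `x` is divisible by `p ^ n` in the `p`-adic
sense. -/
def PadicDvd (p : ℕ) (n : ℤ) (x : ℚ) : Prop :=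
  padicNorm p x ≤ (p : ℚ) ^ (-n)

namespace PadicDvd

section

variable {p : ℕ} {n : ℤ} {x y : ℚ}

theorem of_eq (hx : PadicDvd p n x) (h : x = y) : PadicDvd p n y :=
  h ▸ hx

theorem neg (hx : PadicDvd p n x) : PadicDvd p n (-x) := by
  simpa [PadicDvd] using hx

theorem zero : PadicDvd p n 0 := by
  simp only [PadicDvd, padicNorm.zero]
  positivity

end

section

variable {p : ℕ} [hp : Fact p.Prime] {n m : ℤ} {x y : ℚ}

theorem add (hx : PadicDvd p n x) (hy : PadicDvd p n y) : PadicDvd p n (x + y) :=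
  padicNorm.nonarchimedean.trans (max_le hx hy)

theorem sub (hx : PadicDvd p n x) (hy : PadicDvd p n y) : PadicDvd p n (x - y) :=
  padicNorm.sub.trans (max_le hx hy)

theorem mul (hx : PadicDvd p n x) (hy : PadicDvd p m y) : PadicDvd p (n + m) (x * y) := by
  have h0 : (p : ℚ) ≠ 0 := by exact_mod_cast hp.out.ne_zero
  unfold PadicDvd at *
  rw [padicNorm.mul, neg_add, zpow_add₀ h0]
  exact mul_le_mul hx hy (padicNorm.nonneg _) (by positivity)

theorem mono (hx : PadicDvd p n x) (h : m ≤ n) : PadicDvd p m x := by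
  refine le_trans hx (zpow_le_zpow_right₀ ?_ (by lia))
  exact_mod_cast hp.out.one_le

theorem mul_left (hx : PadicDvd p n x) (hy : PadicDvd p 0 y) : PadicDvd p n (y * x) := by
  simpa using hy.mul hx

theorem mul_right (hx : PadicDvd p n x) (hy : PadicDvd p 0 y) : PadicDvd p n (x * y) := by
  simpa using hx.mul hy

theorem intCast (z : ℤ) : PadicDvd p 0 (z : ℚ) := by
  simpa [PadicDvd] using padicNorm.of_int (p := p) z

theorem natCast (z : ℕ) : PadicDvd p 0 (z : ℚ) := by
  simpa [PadicDvd] using padicNorm.of_nat (p := p) z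

theorem ofNat (z : ℕ) [z.AtLeastTwo] : PadicDvd p 0 (OfNat.ofNat z : ℚ) := by
  simpa using natCast (p := p) (OfNat.ofNat z)

theorem one : PadicDvd p 0 1 := by
  simpa using natCast (p := p) 1

theorem zpow_self (n : ℤ) : PadicDvd p n ((p : ℚ) ^ n) := by
  have : padicNorm p ((p : ℚ) ^ n) = (padicNorm p p) ^ n :=
    map_zpow₀ (⟨⟨padicNorm p, padicNorm.zero⟩, padicNorm.one, padicNorm.mul⟩ : ℚ →*₀ ℚ) _ _
  rw [PadicDvd, this, padicNorm.padicNorm_p_of_prime, inv_zpow, zpow_neg]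

theorem pow_self (n : ℕ) : PadicDvd p n ((p : ℚ) ^ n) := by
  simpa using zpow_self (p := p) (n : ℤ)

theorem self : PadicDvd p 1 (p : ℚ) := by
  simpa using pow_self (p := p) 1

theorem pow (hx : PadicDvd p 0 x) (k : ℕ) : PadicDvd p 0 (x ^ k) := by
  induction k with
  | zero => simpa using one
  | succ k ih => rw [pow_succ]; exact ih.mul_right hx

theorem sum {ι : Type*} {s : Finset ι} {f : ι → ℚ} (h : ∀ i ∈ s, PadicDvd p n (f i)) :
    PadicDvd p n (∑ i ∈ s, f i) :=
  Finset.sum_induction _ (PadicDvd p n) (fun _ _ => add) zero h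

theorem of_dvd {k : ℕ} {z : ℤ} (h : (p : ℤ) ^ k ∣ z) : PadicDvd p k (z : ℚ) :=
  padicNorm.dvd_iff_norm_le.1 (by exact_mod_cast h)

theorem of_zpow_mul (k : ℤ) (h : PadicDvd p (k + n) ((p : ℚ) ^ k * x)) : PadicDvd p n x := by
  have h0 : (p : ℚ) ≠ 0 := by exact_mod_cast hp.out.ne_zero
  have := (zpow_self (p := p) (-k)).mul h
  rwa [neg_add_cancel_left, ← mul_assoc, ← zpow_add₀ h0, neg_add_cancel, zpow_zero, one_mul]
    at this

theorem of_pow_mul (k : ℕ) (h : PadicDvd p (k + n) ((p : ℚ) ^ k * x)) : PadicDvd p n x :=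
  of_zpow_mul k (by simpa using h)

theorem of_unit_mul {z : ℤ} (hz : ¬ (p : ℤ) ∣ z) (h : PadicDvd p n ((z : ℚ) * x)) :
    PadicDvd p n x := by
  have := (padicNorm.int_eq_one_iff (p := p) z).2 hz
  rwa [PadicDvd, padicNorm.mul, this, one_mul] at h

theorem inv_natCast {k : ℕ} (hk : ¬ p ∣ k) : PadicDvd p 0 ((k : ℚ)⁻¹) := by
  have h0 : (k : ℚ) ≠ 0 := by
    rintro h
    exact hk (by simp [Nat.cast_eq_zero.1 h])
  refine of_unit_mul (z := k) (by exact_mod_cast hk) ?_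
  rw [Int.cast_natCast, mul_inv_cancel₀ h0]
  exact one

theorem inv_natCast_of_lt {k : ℕ} (hk0 : 0 < k) (hk : k < p) : PadicDvd p 0 ((k : ℚ)⁻¹) :=
  inv_natCast (Nat.not_dvd_of_pos_of_lt hk0 hk)

theorem of_ofNat_mul (k : ℕ) [k.AtLeastTwo] (hk : k < p)
    (h : PadicDvd p n ((OfNat.ofNat k : ℚ) * x)) : PadicDvd p n x := by
  have hk2 : 2 ≤ k := Nat.AtLeastTwo.prop
  have h1 : PadicDvd p n ((k : ℚ) * x) := h
  refine of_unit_mul (z := k) ?_ (by exact_mod_cast h1)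
  exact_mod_cast Nat.not_dvd_of_pos_of_lt (by lia) hk

theorem inv_natCast_of_lt_pow {k e : ℕ} (hk : k ≠ 0) (h : k < p ^ (e + 1)) :
    PadicDvd p (-e) ((k : ℚ)⁻¹) := by
  obtain ⟨v, u, hu, rfl⟩ := Nat.exists_eq_pow_mul_and_not_dvd hk p hp.out.ne_one
  have hu0 : 0 < u := Nat.pos_of_ne_zero (by rintro rfl; simp at hu)
  have hv : v < e + 1 := (Nat.pow_lt_pow_iff_right hp.out.one_lt).1
    (lt_of_le_of_lt (Nat.le_mul_of_pos_right _ hu0) h)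
  have : (((p ^ v * u : ℕ) : ℚ)⁻¹) = (p : ℚ) ^ (-(v : ℤ)) * (u : ℚ)⁻¹ := by
    push_cast
    rw [mul_inv, zpow_neg, zpow_natCast]
  rw [this]
  exact ((zpow_self (-(v : ℤ))).mul_right (inv_natCast hu)).mono (by lia)

end

end PadicDvd

theorem padicCong_iff_padicDvd {p n : ℕ} {a b : ℚ} :
    PadicCong p n a b ↔ PadicDvd p n (a - b) :=
  Iff.rfl

attribute [irreducible] PadicDvd

theorem add_seven_lt_pow {p : ℕ} (hp11 : 11 ≤ p) (j : ℕ) : j + 7 < p ^ (j + 1) := by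
  refine lt_of_lt_of_le ?_ (Nat.pow_le_pow_left hp11 _)
  induction j with
  | zero => norm_num
  | succ j ih => rw [pow_succ]; lia

theorem sum_range_pow_eq_sum_choose (n m : ℕ) :
    ∑ k ∈ Finset.range n, (k : ℚ) ^ m =
      ∑ i ∈ Finset.range (m + 1),
        (m.choose i : ℚ) * ((n : ℚ) ^ (i + 1) * ((i + 1 : ℕ) : ℚ)⁻¹) * bernoulli (m - i) := by
  rw [sum_range_pow, ← Finset.sum_range_reflect]
  refine Finset.sum_congr rfl fun i hi => ?_
  have hi' : i ≤ m := by simpa [Nat.lt_succ_iff] using hi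
  have h1 : m + 1 - 1 - i = m - i := by lia
  have h2 : m + 1 - (m - i) = i + 1 := by lia
  have h3 : (m + 1).choose (m - i) = (m + 1).choose (i + 1) := by
    rw [← Nat.choose_symm (by lia : i + 1 ≤ m + 1)]
    congr 1
    lia
  rw [h1, h2, h3]
  have h4 : ((m + 1 : ℕ) : ℚ) * m.choose i = (m + 1).choose (i + 1) * ((i + 1 : ℕ) : ℚ) := by
    exact_mod_cast Nat.add_one_mul_choose_eq m i
  have : ((m + 1).choose (i + 1) : ℚ) = (m + 1) * m.choose i * ((i + 1 : ℕ) : ℚ)⁻¹ := by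
    rw [eq_mul_inv_iff_mul_eq₀ (by positivity), ← h4]
    push_cast
    ring
  rw [this]
  have : (m : ℚ) + 1 ≠ 0 := by positivity
  field_simp

section

variable {p : ℕ} [hp : Fact p.Prime]

theorem padicDvd_mul_bernoulli (m : ℕ) : PadicDvd p 0 (p * bernoulli m) := by
  induction m using Nat.strong_induction_on with
  | _ m ih =>
    have h := sum_range_pow_eq_sum_choose p m
    rw [Finset.sum_range_succ'] at h
    have h' : (p : ℚ) * bernoulli m = ∑ k ∈ Finset.range p, (k : ℚ) ^ m -
        ∑ i ∈ Finset.range m, (m.choose (i + 1) : ℚ) *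
          ((p : ℚ) ^ (i + 1 + 1) * ((i + 1 + 1 : ℕ) : ℚ)⁻¹) * bernoulli (m - (i + 1)) := by
      rw [h]
      simp
    rw [h']
    refine .sub (.sum fun k _ => (PadicDvd.natCast k).pow m) (.sum fun i hi => ?_)
    have hi' := Finset.mem_range.1 hi
    have hlt : i + 2 < p ^ (i + 1 + 1) :=
      (Nat.lt_pow_self (by norm_num : 1 < 2)).trans_le (Nat.pow_le_pow_left hp.out.two_le _)
    have h1 := ((PadicDvd.pow_self (p := p) (i + 1)).mul
      (PadicDvd.inv_natCast_of_lt_pow (by lia) hlt)).mul_left (PadicDvd.natCast (m.choose (i + 1)))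
    have h2 := h1.mul (ih (m - (i + 1)) (by lia))
    refine (h2.mono (m := 0) (by push_cast; lia)).of_eq ?_
    push_cast
    ring

theorem padicDvd_bernoulli_neg_one (m : ℕ) : PadicDvd p (-1) (bernoulli m) :=
  .of_pow_mul 1 (by simpa using padicDvd_mul_bernoulli m)

theorem padicDvd_pow_mul_inv_natCast {N i e : ℕ} (h : i + 1 < p ^ (e + 1)) :
    PadicDvd p (N * (i + 1) - e) (((p ^ N : ℕ) : ℚ) ^ (i + 1) * ((i + 1 : ℕ) : ℚ)⁻¹) := by
  have h1 := (PadicDvd.pow_self (p := p) (N * (i + 1))).mul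
    (PadicDvd.inv_natCast_of_lt_pow (by lia) h)
  rw [pow_mul] at h1
  push_cast at h1 ⊢
  exact h1

/-- A power sum over a complete range modulo `p ^ N` determines the Bernoulli number
modulo `p ^ N`. -/
theorem padicDvd_sum_pow_sub (hp11 : 11 ≤ p) {N m : ℕ} (hN : 1 ≤ N) (hm : 4 ≤ m) (he : Even m) :
    PadicDvd p (2 * N)
      (∑ k ∈ Finset.range (p ^ N), (k : ℚ) ^ m - ((p ^ N : ℕ) : ℚ) * bernoulli m) := by
  obtain ⟨r, rfl⟩ : ∃ r, m = r + 1 := ⟨m - 1, by lia⟩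
  have hodd : bernoulli r = 0 := bernoulli_eq_zero_of_odd (by grind) (by lia)
  rw [sum_range_pow_eq_sum_choose, Finset.sum_range_succ', Finset.sum_range_succ']
  simp only [Nat.choose_zero_right, zero_add, pow_one, Nat.cast_one, inv_one, mul_one, one_mul,
    Nat.sub_zero, Nat.add_sub_cancel, hodd, mul_zero, add_zero, add_sub_cancel_right]
  refine PadicDvd.sum fun i _ => ?_
  have hlt : i + 1 + 1 + 1 < p ^ (i + 1) := by
    have := add_seven_lt_pow hp11 i
    lia
  refine (((padicDvd_pow_mul_inv_natCast (N := N) hlt).mul_left (PadicDvd.natCast _)).mul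
    (padicDvd_bernoulli_neg_one _)).mono ?_
  push_cast
  nlinarith

/-- Second-order comparison of a power sum over `0, …, p - 1` with Bernoulli numbers. -/
theorem padicDvd_sum_pow_sub_sub (hp11 : 11 ≤ p) {m : ℕ} (hm : 8 ≤ m) (he : Even m)
    (hint : PadicDvd p 0 (bernoulli (m - 4))) :
    PadicDvd p 5 (∑ k ∈ Finset.range p, (k : ℚ) ^ m - p * bernoulli m -
      m * (m - 1) / 6 * (p : ℚ) ^ 3 * bernoulli (m - 2)) := by
  obtain ⟨r, rfl⟩ : ∃ r, m = r + 6 := ⟨m - 6, by lia⟩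
  have h1 : bernoulli (r + 6 - 1) = 0 := bernoulli_eq_zero_of_odd (by grind) (by lia)
  have h3 : bernoulli (r + 6 - 3) = 0 := bernoulli_eq_zero_of_odd (by grind) (by lia)
  have h5 : bernoulli (r + 6 - 5) = 0 := bernoulli_eq_zero_of_odd (by grind) (by lia)
  have key : ∑ k ∈ Finset.range p, (k : ℚ) ^ (r + 6) - p * bernoulli (r + 6) -
      ((r + 6 : ℕ) : ℚ) * ((r + 6 : ℕ) - 1) / 6 * (p : ℚ) ^ 3 * bernoulli (r + 6 - 2) =
      ((r + 6).choose 4 : ℚ) * ((p : ℚ) ^ 5 * ((5 : ℕ) : ℚ)⁻¹) * bernoulli (r + 6 - 4) +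
      ∑ i ∈ Finset.range (r + 1), ((r + 6).choose (i + 6) : ℚ) *
        (((p ^ 1 : ℕ) : ℚ) ^ (i + 6 + 1) * ((i + 6 + 1 : ℕ) : ℚ)⁻¹) *
          bernoulli (r + 6 - (i + 6)) := by
    rw [sum_range_pow_eq_sum_choose, show r + 6 + 1 = r + 1 + 1 + 1 + 1 + 1 + 1 + 1 by ring]
    iterate 6 rw [Finset.sum_range_succ']
    simp only [zero_add, Nat.reduceAdd, h1, h3, h5, Nat.cast_choose_two, add_assoc, mul_zero,
      add_zero, pow_one, Nat.choose_zero_right, Nat.sub_zero]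
    push_cast
    ring
  rw [key]
  refine .add ?_ (.sum fun i _ => ?_)
  · exact (((PadicDvd.pow_self 5).mul_right (PadicDvd.inv_natCast
      (Nat.not_dvd_of_pos_of_lt (by norm_num) (by lia)))).mul_left (.natCast _)).mul_right hint
  · have hlt : i + 6 + 1 < p ^ (i + 1) := add_seven_lt_pow hp11 i
    refine (((padicDvd_pow_mul_inv_natCast (N := 1) hlt).mul_left (PadicDvd.natCast _)).mul
      (padicDvd_bernoulli_neg_one _)).mono ?_
    push_cast
    lia

end

section

variable {p : ℕ} [hp : Fact p.Prime]

theorem exists_not_dvd_pow_sub_one {m : ℕ} (hm : ¬ (p - 1) ∣ m) :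
    ∃ a : ℕ, ¬ p ∣ a ∧ ¬ (p : ℤ) ∣ (a : ℤ) ^ m - 1 := by
  have h := mt (FiniteField.forall_pow_eq_one_iff (ZMod p) m).1 (by rwa [ZMod.card])
  push Not at h
  obtain ⟨u, hu⟩ := h
  refine ⟨(u : ZMod p).val, ?_, ?_⟩
  · rw [← ZMod.natCast_eq_zero_iff, ZMod.natCast_zmod_val]
    exact u.ne_zero
  · rw [← ZMod.intCast_zmod_eq_zero_iff_dvd]
    push_cast
    rw [ZMod.natCast_zmod_val, sub_eq_zero]
    exact fun h => hu (Units.ext (by simpa using h))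

theorem pow_dvd_pow_sub_pow {N m : ℕ} (hN : 1 ≤ N) (hm : N ≤ m) (t : ℕ) (r : ℤ) :
    (p : ℤ) ^ N ∣ r ^ (m + p ^ (N - 1) * (p - 1) * t) - r ^ m := by
  by_cases hr : (p : ℤ) ∣ r
  · have h1 : (p : ℤ) ^ N ∣ r ^ m := (pow_dvd_pow_of_dvd hr N).trans (pow_dvd_pow r hm)
    exact dvd_sub (by rw [pow_add]; exact h1.mul_right _) h1
  · have hc : IsCoprime ((p ^ N : ℕ) : ℤ) r := by
      push_cast
      exact ((Nat.prime_iff_prime_int.1 hp.out).coprime_iff_not_dvd.2 hr).pow_left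
    have h2 : r ^ (p ^ N).totient ≡ 1 [ZMOD (p ^ N : ℕ)] := by
      rw [← ZMod.intCast_eq_intCast_iff]
      obtain ⟨u, hu⟩ := (ZMod.coe_int_isUnit_iff_isCoprime _ _).2 hc
      push_cast
      rw [← hu, ← Units.val_pow_eq_pow_val, ZMod.pow_totient, Units.val_one]
    rw [Nat.totient_prime_pow hp.out (by lia)] at h2
    have h3 := ((h2.pow t).mul_left (r ^ m)).symm.dvd
    rw [one_pow, mul_one, ← pow_mul, ← pow_add] at h3
    simpa using h3

/-- Multiplication by a unit permutes the residues modulo `P`. -/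
theorem sum_range_mul_mod {P a : ℕ} (hP : 0 < P) (ha : Nat.Coprime P a) {M : Type*}
    [AddCommMonoid M] (f : ℕ → M) :
    ∑ j ∈ Finset.range P, f (a * j % P) = ∑ j ∈ Finset.range P, f j := by
  have hinj : Set.InjOn (fun j => a * j % P) (Finset.range P : Set ℕ) := by
    intro i hi j hj hij
    have h : i ≡ j [MOD P] := Nat.ModEq.cancel_left_of_coprime ha hij
    exact h.eq_of_lt_of_lt (by simpa using hi) (by simpa using hj)
  have himg : (Finset.range P).image (fun j => a * j % P) = Finset.range P := by
    refine Finset.eq_of_subset_of_card_le ?_ (Finset.card_image_of_injOn hinj).ge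
    intro x hx
    obtain ⟨j, _, rfl⟩ := Finset.mem_image.1 hx
    exact Finset.mem_range.2 (Nat.mod_lt _ hP)
  conv_rhs => rw [← himg, Finset.sum_image hinj]

/-- The sum occurring in Voronoi's congruence for Bernoulli numbers. -/
def voronoiSum (P a m : ℕ) : ℤ :=
  ∑ j ∈ Finset.range P, ((a * j / P : ℕ) : ℤ) * ((a * j % P : ℕ) : ℤ) ^ (m - 1)

theorem sq_dvd_sum_pow_sub_voronoiSum {P a : ℕ} (hP : 0 < P) (ha : Nat.Coprime P a) (m : ℕ) :
    (P : ℤ) ^ 2 ∣ ((a : ℤ) ^ m - 1) * ∑ j ∈ Finset.range P, (j : ℤ) ^ m -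
      m * P * voronoiSum P a m := by
  have h1 : ((a : ℤ) ^ m - 1) * ∑ j ∈ Finset.range P, (j : ℤ) ^ m - m * P * voronoiSum P a m =
      ∑ j ∈ Finset.range P, (((a * j : ℕ) : ℤ) ^ m - ((a * j % P : ℕ) : ℤ) ^ m -
        m * P * (((a * j / P : ℕ) : ℤ) * ((a * j % P : ℕ) : ℤ) ^ (m - 1))) := by
    rw [Finset.sum_sub_distrib, Finset.sum_sub_distrib,
      sum_range_mul_mod hP ha (fun j => (j : ℤ) ^ m), ← Finset.mul_sum, voronoiSum, sub_mul,
      one_mul, Finset.mul_sum]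
    simp only [Nat.cast_mul, mul_pow]
  rw [h1]
  refine Finset.dvd_sum fun j _ => ?_
  obtain ⟨k, hk⟩ := Polynomial.powAddExpansion ((a * j % P : ℕ) : ℤ) (P * (a * j / P : ℕ)) m
  have h2 : ((a * j : ℕ) : ℤ) = (a * j % P : ℕ) + P * (a * j / P : ℕ) := by
    exact_mod_cast (Nat.mod_add_div (a * j) P).symm
  rw [h2, hk]
  exact ⟨k * (a * j / P : ℕ) ^ 2, by ring⟩

theorem pow_dvd_voronoiSum_sub {N m a : ℕ} (hN : 1 ≤ N) (hm : N + 1 ≤ m) (t : ℕ) :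
    (p : ℤ) ^ N ∣ voronoiSum (p ^ N) a (m + p ^ (N - 1) * (p - 1) * t) -
      voronoiSum (p ^ N) a m := by
  rw [voronoiSum, voronoiSum, ← Finset.sum_sub_distrib]
  refine Finset.dvd_sum fun j _ => ?_
  rw [← mul_sub, Nat.sub_add_comm (by lia)]
  exact (pow_dvd_pow_sub_pow hN (by lia) t _).mul_left _

/-- **Voronoi's congruence** for Bernoulli numbers modulo `p ^ N`. -/
theorem padicDvd_pow_sub_one_mul_bernoulli_sub (hp11 : 11 ≤ p) {N m a : ℕ} (hN : 1 ≤ N)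
    (hm : 4 ≤ m) (he : Even m) (ha : ¬ p ∣ a) :
    PadicDvd p N (((a : ℚ) ^ m - 1) * bernoulli m - m * voronoiSum (p ^ N) a m) := by
  have hc : Nat.Coprime (p ^ N) a := ((Nat.Prime.coprime_iff_not_dvd hp.out).2 ha).pow_left N
  have h1 := sq_dvd_sum_pow_sub_voronoiSum (pow_pos hp.out.pos N) hc m
  have h2 : PadicDvd p (N * 2 : ℕ) (((((a : ℤ) ^ m - 1) * ∑ j ∈ Finset.range (p ^ N), (j : ℤ) ^ m -
      m * (p ^ N : ℕ) * voronoiSum (p ^ N) a m : ℤ)) : ℚ) :=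
    .of_dvd (by rw [pow_mul]; exact_mod_cast h1)
  have h3 := (padicDvd_sum_pow_sub hp11 hN hm he).mul_left
    (((PadicDvd.natCast a).pow m).sub PadicDvd.one)
  refine .of_pow_mul N ?_
  refine ((h2.sub (h3.mono (by push_cast; lia))).mono (m := N + N) (by push_cast; lia)).of_eq ?_
  push_cast
  ring

theorem padicDvd_bernoulli_zero (hp11 : 11 ≤ p) {m : ℕ} (hm : 4 ≤ m) (he : Even m)
    (hdvd : ¬ (p - 1) ∣ m) : PadicDvd p 0 (bernoulli m) := by
  obtain ⟨a, ha, ha'⟩ := exists_not_dvd_pow_sub_one hdvd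
  have h := (padicDvd_pow_sub_one_mul_bernoulli_sub hp11 le_rfl hm he ha).mono (m := 0) (by simp)
  refine .of_unit_mul ha' ?_
  have h2 := h.add ((PadicDvd.intCast (voronoiSum (p ^ 1) a m)).mul_left (PadicDvd.natCast m))
  refine h2.of_eq ?_
  push_cast
  ring

/-- **Kummer's congruence** for Bernoulli numbers modulo `p ^ N`. -/
theorem padicDvd_kummer (hp11 : 11 ≤ p) {N m : ℕ} (hN : 1 ≤ N) (hm : 4 ≤ m) (hNm : N + 1 ≤ m)
    (he : Even m) (hdvd : ¬ (p - 1) ∣ m) (t : ℕ) :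
    PadicDvd p N (m * bernoulli (m + p ^ (N - 1) * (p - 1) * t) -
      ((m + p ^ (N - 1) * (p - 1) * t : ℕ) : ℚ) * bernoulli m) := by
  obtain ⟨a, ha, ha'⟩ := exists_not_dvd_pow_sub_one hdvd
  have hpe : Even (p - 1) := hp.out.even_sub_one (by lia)
  have he' : Even (m + p ^ (N - 1) * (p - 1) * t) := he.add ((hpe.mul_left _).mul_right _)
  have hV := PadicDvd.of_dvd (pow_dvd_voronoiSum_sub (p := p) (a := a) hN hNm t)
  have hA := PadicDvd.of_dvd (pow_dvd_pow_sub_pow (p := p) hN (by lia : N ≤ m) t a)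
  have hint : PadicDvd p 0 (bernoulli (m + p ^ (N - 1) * (p - 1) * t)) :=
    padicDvd_bernoulli_zero hp11 (by lia) he' (fun h => hdvd
      ((Nat.dvd_add_left (((dvd_refl _).mul_left _).mul_right _)).1 h))
  set m' := m + p ^ (N - 1) * (p - 1) * t
  have h1 := padicDvd_pow_sub_one_mul_bernoulli_sub hp11 hN hm he ha
  have h2 := padicDvd_pow_sub_one_mul_bernoulli_sub hp11 hN (by lia : 4 ≤ m') he' ha
  refine .of_unit_mul ha' ?_
  refine ((((h2.mul_left (.natCast m)).sub (h1.mul_left (.natCast m'))).add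
    (hV.mul_left ((PadicDvd.natCast m).mul_left (.natCast m')))).sub
    ((hA.mul_right hint).mul_left (.natCast m))).of_eq ?_
  push_cast
  ring

end

/-- The power sum `∑ k⁻ⁿ` of the inverses of `1, …, p - 1`. -/
def invPowSum (p n : ℕ) : ℚ :=
  ∑ k ∈ Finset.Ico 1 p, ((k : ℚ)⁻¹) ^ n

/-- The power sum `∑ (k (p - k))⁻ⁿ` over `1, …, p - 1`. -/
def invMulPowSum (p n : ℕ) : ℚ :=
  ∑ k ∈ Finset.Ico 1 p, (((k : ℚ) * (p - k : ℕ))⁻¹) ^ n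

theorem sum_Ico_one_reflect {M : Type*} [AddCommMonoid M] (p : ℕ) (f : ℕ → M) :
    ∑ k ∈ Finset.Ico 1 p, f (p - k) = ∑ k ∈ Finset.Ico 1 p, f k := by
  rw [Finset.sum_Ico_reflect f 1 (Nat.le_succ p)]
  simp

theorem prod_Ico_one_reflect {M : Type*} [CommMonoid M] (p : ℕ) (f : ℕ → M) :
    ∏ k ∈ Finset.Ico 1 p, f (p - k) = ∏ k ∈ Finset.Ico 1 p, f k := by
  rw [Finset.prod_Ico_reflect f 1 (Nat.le_succ p)]
  simp

theorem two_mul_invPowSum (p n : ℕ) :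
    2 * invPowSum p n =
      ∑ k ∈ Finset.Ico 1 p, (((k : ℚ)⁻¹) ^ n + (((p - k : ℕ) : ℚ)⁻¹) ^ n) := by
  rw [Finset.sum_add_distrib, sum_Ico_one_reflect p (fun k => ((k : ℚ)⁻¹) ^ n), invPowSum]
  ring

theorem inv_add_inv_sub {p k : ℕ} (hk : k ∈ Finset.Ico 1 p) :
    (k : ℚ)⁻¹ + ((p - k : ℕ) : ℚ)⁻¹ = p * ((k : ℚ) * (p - k : ℕ))⁻¹ := by
  obtain ⟨h1, h2⟩ := Finset.mem_Ico.1 hk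
  have hk0 : (k : ℚ) ≠ 0 := by exact_mod_cast (by lia : k ≠ 0)
  have hk1 : ((p - k : ℕ) : ℚ) ≠ 0 := by exact_mod_cast (by lia : p - k ≠ 0)
  have hk2 : (p : ℚ) = k + (p - k : ℕ) := by exact_mod_cast (by lia : p = k + (p - k))
  rw [hk2]
  field_simp
  ring

theorem two_mul_invPowSum_two (p : ℕ) :
    2 * invPowSum p 2 = (p : ℚ) ^ 2 * invMulPowSum p 2 - 2 * invMulPowSum p 1 := by
  rw [two_mul_invPowSum, invMulPowSum, invMulPowSum, Finset.mul_sum, Finset.mul_sum,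
    ← Finset.sum_sub_distrib]
  refine Finset.sum_congr rfl fun k hk => ?_
  have h := inv_add_inv_sub hk
  rw [mul_inv] at h ⊢
  linear_combination ((k : ℚ)⁻¹ + ((p - k : ℕ) : ℚ)⁻¹ +
    p * ((k : ℚ)⁻¹ * ((p - k : ℕ) : ℚ)⁻¹)) * h

theorem two_mul_invPowSum_four (p : ℕ) :
    2 * invPowSum p 4 = (p : ℚ) ^ 4 * invMulPowSum p 4 - 4 * (p : ℚ) ^ 2 * invMulPowSum p 3 +
      2 * invMulPowSum p 2 := by
  rw [two_mul_invPowSum, invMulPowSum, invMulPowSum, invMulPowSum, Finset.mul_sum, Finset.mul_sum,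
    Finset.mul_sum, ← Finset.sum_sub_distrib, ← Finset.sum_add_distrib]
  refine Finset.sum_congr rfl fun k hk => ?_
  have h := inv_add_inv_sub hk
  rw [mul_inv] at h ⊢
  generalize (k : ℚ)⁻¹ = x at *
  generalize ((p - k : ℕ) : ℚ)⁻¹ = y at *
  have h2 : (p : ℚ) ^ 2 * (x * y) ^ 2 = (x + y) ^ 2 := by rw [h]; ring
  linear_combination (-(p : ℚ) ^ 2 * (x * y) ^ 2 - (x + y) ^ 2 + 4 * (x * y)) * h2

theorem choose_eq_prod (p : ℕ) (hp : 1 ≤ p) :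
    ((2 * p - 1).choose (p - 1) : ℚ) = ∏ k ∈ Finset.Ico 1 p, (1 + p * (k : ℚ)⁻¹) := by
  obtain ⟨q, rfl⟩ : ∃ q, p = q + 1 := ⟨p - 1, by lia⟩
  have h := Nat.ascFactorial_eq_factorial_mul_choose (q + 1) q
  rw [Nat.ascFactorial_eq_prod_range, ← Finset.prod_range_add_one_eq_factorial] at h
  rw [Finset.prod_Ico_eq_prod_range, show 2 * (q + 1) - 1 = q + 1 + q by lia,
    Nat.add_sub_cancel]
  have h0 : ∏ i ∈ Finset.range q, ((i : ℚ) + 1) ≠ 0 :=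
    Finset.prod_ne_zero_iff.2 fun i _ => by positivity
  refine mul_left_cancel₀ h0 ?_
  rw [← Finset.prod_mul_distrib]
  refine (by exact_mod_cast h.symm : _ = _).trans
    ((Nat.cast_prod _ _).trans (Finset.prod_congr rfl fun i _ => ?_))
  have : (1 : ℚ) + i ≠ 0 := by positivity
  push_cast
  field_simp
  ring

theorem choose_sq_eq_prod (p : ℕ) (hp : 1 ≤ p) :
    ((2 * p - 1).choose (p - 1) : ℚ) ^ 2 =
      ∏ k ∈ Finset.Ico 1 p, (1 + 2 * (p : ℚ) ^ 2 * ((k : ℚ) * (p - k : ℕ))⁻¹) := by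
  rw [sq, choose_eq_prod p hp]
  conv_lhs =>
    enter [2]
    rw [← prod_Ico_one_reflect p (fun k => 1 + p * (k : ℚ)⁻¹)]
  rw [← Finset.prod_mul_distrib]
  refine Finset.prod_congr rfl fun k hk => ?_
  have h := inv_add_inv_sub hk
  rw [mul_inv] at h ⊢
  linear_combination (p : ℚ) * h

theorem not_sub_one_dvd {p n m e : ℕ} (hn0 : 0 < n) (hn : n < p - 1)
    (h : m + n = p ^ e * (p - 1)) : ¬ (p - 1) ∣ m := fun hd =>
  Nat.not_dvd_of_pos_of_lt hn0 hn
    ((Nat.dvd_add_right hd).1 (h ▸ Dvd.intro_left _ rfl))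

section

variable {p : ℕ} [hp : Fact p.Prime]

/-- Newton's identities for a product `∏ (1 + t y)` modulo `t ^ 4`. -/
theorem exists_six_mul_prod_one_add_eq {ι : Type*} (s : Finset ι) (y : ι → ℚ) {t : ℚ}
    (ht : PadicDvd p 0 t) (hy : ∀ i ∈ s, PadicDvd p 0 (y i)) :
    ∃ R, PadicDvd p 0 R ∧ 6 * ∏ i ∈ s, (1 + t * y i) =
      6 + 6 * t * ∑ i ∈ s, y i ^ 1 + 3 * t ^ 2 * ((∑ i ∈ s, y i ^ 1) ^ 2 - ∑ i ∈ s, y i ^ 2) +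
      t ^ 3 * ((∑ i ∈ s, y i ^ 1) ^ 3 - 3 * (∑ i ∈ s, y i ^ 1) * ∑ i ∈ s, y i ^ 2 +
        2 * ∑ i ∈ s, y i ^ 3) + t ^ 4 * R := by
  classical
  induction s using Finset.induction_on with
  | empty => exact ⟨0, .zero, by simp⟩
  | insert a s ha ih =>
    have hs : ∀ i ∈ s, PadicDvd p 0 (y i) := fun i hi => hy i (Finset.mem_insert_of_mem hi)
    have hya := hy a (Finset.mem_insert_self a s)
    have hsum : ∀ n, PadicDvd p 0 (∑ i ∈ s, y i ^ n) := fun n => .sum fun i hi => (hs i hi).pow n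
    obtain ⟨R, hR, h⟩ := ih hs
    refine ⟨R * (1 + t * y a) + ((∑ i ∈ s, y i ^ 1) ^ 3 -
      3 * (∑ i ∈ s, y i ^ 1) * ∑ i ∈ s, y i ^ 2 + 2 * ∑ i ∈ s, y i ^ 3) * y a, ?_, ?_⟩
    · exact (hR.mul_right (.add .one (ht.mul_right hya))).add (.mul_right
        (.add (.sub ((hsum 1).pow 3) ((hsum 2).mul_left ((hsum 1).mul_left (.ofNat 3))))
          ((hsum 3).mul_left (.ofNat 2))) hya)
    · simp only [Finset.sum_insert ha, Finset.prod_insert ha]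
      linear_combination (1 + t * y a) * h

theorem padicDvd_inv_of_mem_Ico {k : ℕ} (hk : k ∈ Finset.Ico 1 p) : PadicDvd p 0 ((k : ℚ)⁻¹) :=
  .inv_natCast_of_lt (Finset.mem_Ico.1 hk).1 (Finset.mem_Ico.1 hk).2

theorem padicDvd_inv_sub_of_mem_Ico {k : ℕ} (hk : k ∈ Finset.Ico 1 p) :
    PadicDvd p 0 (((p - k : ℕ) : ℚ)⁻¹) := by
  have := Finset.mem_Ico.1 hk
  exact .inv_natCast_of_lt (by lia) (by lia)

theorem padicDvd_inv_mul_of_mem_Ico {k : ℕ} (hk : k ∈ Finset.Ico 1 p) :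
    PadicDvd p 0 (((k : ℚ) * (p - k : ℕ))⁻¹) := by
  rw [mul_inv]
  exact (padicDvd_inv_of_mem_Ico hk).mul_right (padicDvd_inv_sub_of_mem_Ico hk)

theorem padicDvd_invMulPowSum (n : ℕ) : PadicDvd p 0 (invMulPowSum p n) :=
  .sum fun _ hk => (padicDvd_inv_mul_of_mem_Ico hk).pow n

theorem padicDvd_invMulPowSum_three_add : PadicDvd p 1 (invMulPowSum p 3 + invPowSum p 6) := by
  rw [invMulPowSum, invPowSum, ← Finset.sum_add_distrib]
  refine .sum fun k hk => ?_
  have h := inv_add_inv_sub hk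
  have hx := padicDvd_inv_of_mem_Ico hk
  have hy := padicDvd_inv_sub_of_mem_Ico hk
  rw [mul_inv] at h ⊢
  generalize (k : ℚ)⁻¹ = x at *
  generalize ((p - k : ℕ) : ℚ)⁻¹ = y at *
  refine (PadicDvd.self.mul_right (y := x * y * x * ((x * y) ^ 2 - x * y * x ^ 2 + (x ^ 2) ^ 2))
    (((hx.mul_right hy).mul_right hx).mul_right (.add (.sub ((hx.mul_right hy).pow 2)
      ((hx.mul_right hy).mul_right (hx.pow 2))) ((hx.pow 2).pow 2)))).of_eq ?_
  linear_combination -x * ((x * y) ^ 2 - x * y * x ^ 2 + (x ^ 2) ^ 2) * h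

theorem padicDvd_invPowSum_sub {n m : ℕ} (hm : m ≠ 0) (h : m + n = p ^ 4 * (p - 1)) :
    PadicDvd p 5 (invPowSum p n - ∑ k ∈ Finset.range p, (k : ℚ) ^ m) := by
  have h0 : ∑ k ∈ Finset.range p, (k : ℚ) ^ m = ∑ k ∈ Finset.Ico 1 p, (k : ℚ) ^ m := by
    rw [Finset.range_eq_Ico, Finset.sum_eq_sum_Ico_succ_bot hp.out.pos]
    simp [hm]
  rw [h0, invPowSum, ← Finset.sum_sub_distrib]
  refine .sum fun k hk => ?_
  have hk0 : (k : ℚ) ≠ 0 := by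
    have := (Finset.mem_Ico.1 hk).1
    exact_mod_cast (by lia : k ≠ 0)
  have h1 := PadicDvd.of_dvd (pow_dvd_pow_sub_pow (p := p) (N := 5) (by norm_num) le_rfl 1 k)
  refine ((h1.mul_left ((padicDvd_inv_of_mem_Ico hk).pow (n + 5))).neg).of_eq ?_
  rw [show 5 + p ^ (5 - 1) * (p - 1) * 1 = m + (n + 5) by rw [mul_one, ← h]; ring]
  push_cast
  rw [mul_sub, pow_add (k : ℚ) m, mul_left_comm, ← mul_pow, inv_mul_cancel₀ hk0, pow_add (k : ℚ)⁻¹ n,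
    mul_assoc, ← mul_pow, inv_mul_cancel₀ hk0]
  ring

theorem even_of_add_eq (hp11 : 11 ≤ p) {n m e : ℕ} (hn : Even n)
    (h : m + n = p ^ e * (p - 1)) : Even m :=
  (Nat.even_add.1 (h ▸ (hp.out.even_sub_one (by lia)).mul_left _)).2 hn

theorem padicDvd_invPowSum_one (hp11 : 11 ≤ p) {n : ℕ} (hn0 : 0 < n) (hn : n < p - 1)
    (he : Even n) : PadicDvd p 1 (invPowSum p n) := by
  have hlarge : 11 * (p - 1) ≤ p ^ 4 * (p - 1) :=
    Nat.mul_le_mul_right _ (hp11.trans (Nat.le_self_pow (by norm_num) p))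
  obtain ⟨m, h⟩ : ∃ m, m + n = p ^ 4 * (p - 1) := ⟨p ^ 4 * (p - 1) - n, by lia⟩
  have hme := even_of_add_eq hp11 he h
  have h1 := padicDvd_invPowSum_sub (by lia) h
  have h2 := padicDvd_sum_pow_sub hp11 le_rfl (by lia : 4 ≤ m) hme
  have h3 := PadicDvd.self.mul_right
    (padicDvd_bernoulli_zero hp11 (by lia : 4 ≤ m) hme (not_sub_one_dvd hn0 hn h))
  refine (((h1.mono (m := 1) (by norm_num)).add (h2.mono (m := 1) (by norm_num))).add h3).of_eq ?_
  rw [pow_one]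
  ring

end

section

variable {p : ℕ} [hp : Fact p.Prime]

/-- For a Wolstenholme prime, the binomial coefficient is determined modulo `p ^ 7` by two
power sums of inverses. -/
theorem padicDvd_choose_sub_one_add (hp11 : 11 ≤ p)
    (hw : PadicDvd p 4 ((2 * p - 1).choose (p - 1) - 1 : ℚ)) :
    PadicDvd p 2 (invPowSum p 2) ∧
      PadicDvd p 7 ((2 * p - 1).choose (p - 1) - 1 + (p : ℚ) ^ 2 * invPowSum p 2 +
        (p : ℚ) ^ 4 * invPowSum p 4 / 2) := by
  have ht : PadicDvd p 0 (2 * (p : ℚ) ^ 2) :=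
    ((PadicDvd.natCast p).pow 2).mul_left (.ofNat 2)
  obtain ⟨R, hR, h⟩ := exists_six_mul_prod_one_add_eq (Finset.Ico 1 p)
    (fun k => ((k : ℚ) * (p - k : ℕ))⁻¹) ht fun k hk => padicDvd_inv_mul_of_mem_Ico hk
  have h2 := two_mul_invPowSum_two p
  have h4 := two_mul_invPowSum_four p
  have hY1 := padicDvd_invMulPowSum (p := p) 1
  have hY2 := padicDvd_invMulPowSum (p := p) 2
  have hY4 := padicDvd_invMulPowSum (p := p) 4
  have hY3 : PadicDvd p 1 (invMulPowSum p 3) :=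
    (padicDvd_invMulPowSum_three_add.sub (padicDvd_invPowSum_one hp11 (n := 6) (by norm_num)
      (by lia) (by decide))).of_eq (by ring)
  rw [← choose_sq_eq_prod p hp.out.one_le] at h
  have hdef : ∀ n, ∑ k ∈ Finset.Ico 1 p, (((k : ℚ) * (p - k : ℕ))⁻¹) ^ n = invMulPowSum p n :=
    fun _ => rfl
  simp only [hdef] at h
  generalize ((2 * p - 1).choose (p - 1) : ℚ) = C at *
  generalize invMulPowSum p 1 = Y₁ at *
  generalize invMulPowSum p 2 = Y₂ at *
  generalize invMulPowSum p 3 = Y₃ at *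
  generalize invMulPowSum p 4 = Y₄ at *
  generalize invPowSum p 2 = H₂ at *
  generalize invPowSum p 4 = H₄ at *
  have hp2 := PadicDvd.pow_self (p := p) 2
  have hp4 := PadicDvd.pow_self (p := p) 4
  have hp6 := PadicDvd.pow_self (p := p) 6
  have hp8 := PadicDvd.pow_self (p := p) 8
  have hsq : PadicDvd p 8 ((C - 1) * (C - 1)) := hw.mul hw
  have h3 : PadicDvd p 0 (Y₁ ^ 3 - 3 * Y₁ * Y₂ + 2 * Y₃) :=
    ((hY1.pow 3).sub (hY2.mul_left (hY1.mul_left (.ofNat 3)))).add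
      ((hY3.mono (by norm_num)).mul_left (.ofNat 2))
  have hY1' : PadicDvd p 2 Y₁ := by
    refine .of_ofNat_mul 6 (by lia) (.of_ofNat_mul 2 (by lia) (.of_pow_mul 2 ?_))
    have e1 : PadicDvd p 4 (6 * ((C - 1) * (C - 1)) + 6 * (2 * (C - 1))) :=
      ((hsq.mono (by norm_num)).mul_left (.ofNat 6)).add
        ((hw.mul_left (.ofNat 2)).mul_left (.ofNat 6))
    have e2 : PadicDvd p 4 ((p : ℚ) ^ 4 * (12 * (Y₁ ^ 2 - Y₂) +
        (8 * p ^ 2 * (Y₁ ^ 3 - 3 * Y₁ * Y₂ + 2 * Y₃) + 16 * p ^ 4 * R))) :=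
      hp4.mul_right (.add (.mul_left (.sub (hY1.pow 2) hY2) (.ofNat 12))
        (.add (h3.mul_left (.mul_left (.pow (.natCast p) 2) (.ofNat 8)))
          (hR.mul_left (.mul_left (.pow (.natCast p) 4) (.ofNat 16)))))
    refine ((e1.sub e2).mono (m := (2 : ℕ) + 2) (by norm_num)).of_eq ?_
    linear_combination h
  have hY3' : PadicDvd p 1 (Y₁ ^ 3 - 3 * Y₁ * Y₂ + 2 * Y₃) :=
    .add (.sub (((hY1'.mono (by norm_num)).mul_right (hY1.pow 2)).of_eq (by ring))
      (.mul_right (.mul_left (hY1'.mono (by norm_num)) (.ofNat 3)) hY2)) (hY3.mul_left (.ofNat 2))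
  constructor
  · refine .of_ofNat_mul 2 (by lia) (((hp2.mul_right hY2).sub (hY1'.mul_left (.ofNat 2))).of_eq ?_)
    linear_combination -h2
  · refine .of_ofNat_mul 6 (by lia) (.of_ofNat_mul 2 (by lia) ?_)
    have e1 : PadicDvd p 7 (12 * (p ^ 4 * (Y₁ * Y₁))) :=
      ((hp4.mul (hY1'.mul hY1')).mono (by norm_num)).mul_left (.ofNat 12)
    have e2 : PadicDvd p 7 (8 * (p ^ 6 * (Y₁ ^ 3 - 3 * Y₁ * Y₂ + 2 * Y₃))) :=
      ((hp6.mul hY3').mono (by norm_num)).mul_left (.ofNat 8)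
    have e3 : PadicDvd p 7 (16 * (p ^ 8 * R)) :=
      ((hp8.mono (by norm_num)).mul_right hR).mul_left (.ofNat 16)
    have e4 : PadicDvd p 7 (6 * ((C - 1) * (C - 1))) :=
      (hsq.mono (by norm_num)).mul_left (.ofNat 6)
    have e5 : PadicDvd p 7 (3 * (p ^ 8 * Y₄)) :=
      ((hp8.mono (by norm_num)).mul_right hY4).mul_left (.ofNat 3)
    have e6 : PadicDvd p 7 (12 * (p ^ 6 * Y₃)) :=
      ((hp6.mul hY3).mono (by norm_num)).mul_left (.ofNat 12)
    refine (((((e1.add e2).add e3).sub e4).add e5).sub e6).of_eq ?_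
    linear_combination -h - 6 * (p : ℚ) ^ 2 * h2 - 3 * (p : ℚ) ^ 4 * h4

/-- The power sum of inverses in terms of Bernoulli numbers. -/
theorem padicDvd_invPowSum_sub_bernoulli (hp11 : 11 ≤ p) {n m : ℕ} (hn : n ≤ 4)
    (he : Even n) (h : m + n = p ^ 4 * (p - 1)) :
    PadicDvd p 5 (invPowSum p n - p * bernoulli m -
      m * (m - 1) / 6 * (p : ℚ) ^ 3 * bernoulli (m - 2)) := by
  have hlarge : 11 * (p - 1) ≤ p ^ 4 * (p - 1) :=
    Nat.mul_le_mul_right _ (hp11.trans (Nat.le_self_pow (by norm_num) p))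
  have h4 : (m - 4) + (n + 4) = p ^ 4 * (p - 1) := by lia
  have h1 := padicDvd_invPowSum_sub (by lia) h
  have h2 := padicDvd_sum_pow_sub_sub hp11 (by lia : 8 ≤ m) (even_of_add_eq hp11 he h)
    (padicDvd_bernoulli_zero hp11 (by lia) (even_of_add_eq hp11 (he.add (by decide)) h4)
      (not_sub_one_dvd (by lia) (by lia) h4))
  exact (h1.add h2).of_eq (by ring)

theorem padicDvd_inv_ofNat (k : ℕ) [k.AtLeastTwo] (hk : k < p) :
    PadicDvd p 0 ((OfNat.ofNat k : ℚ)⁻¹) :=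
  PadicDvd.inv_natCast_of_lt (k := k) (by have : 2 ≤ k := Nat.AtLeastTwo.prop; lia) hk

theorem padicDvd_sub_of_kummer_two (hp11 : 11 ≤ p) {B₂ b₂ : ℚ} (hB₂ : PadicDvd p 1 B₂)
    (ib₂ : PadicDvd p 0 b₂)
    (k₂ : PadicDvd p 4 (((p : ℚ) ^ 4 - p ^ 3 - 2) * B₂ - ((p : ℚ) ^ 5 - p ^ 4 - 2) * b₂)) :
    PadicDvd p 4 (B₂ - b₂) := by
  have h0 := PadicDvd.natCast (p := p) p
  refine .of_ofNat_mul 2 (by lia) ?_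
  have e1 : PadicDvd p 4 ((p : ℚ) ^ 4 * B₂) :=
    (PadicDvd.pow_self 4).mul_right (hB₂.mono (by norm_num))
  have e2 : PadicDvd p 4 ((p : ℚ) ^ 3 * B₂) := (PadicDvd.pow_self 3).mul hB₂
  have e3 : PadicDvd p 4 ((p : ℚ) ^ 4 * ((p - 1) * b₂)) :=
    (PadicDvd.pow_self 4).mul_right (ib₂.mul_left (h0.sub .one))
  exact (((e1.sub e2).sub k₂).sub e3).of_eq (by ring)

theorem padicDvd_sub_of_kummer_four (hp11 : 11 ≤ p) {B₄ b₄ γ : ℚ} (i₄ : PadicDvd p 0 B₄)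
    (ib₄ : PadicDvd p 0 b₄) (iγ : PadicDvd p 0 γ)
    (k₄ : PadicDvd p 2 (((p : ℚ) ^ 2 - p - 4) * B₄ - ((p : ℚ) ^ 5 - p ^ 4 - 4) * b₄))
    (kγ : PadicDvd p 1 (((p : ℚ) - 5) * b₄ - ((p : ℚ) ^ 2 - p - 4) * γ)) :
    PadicDvd p 2 (10 * (B₄ - b₄) + 2 * p * γ) := by
  have h0 := PadicDvd.natCast (p := p) p
  have hself := PadicDvd.self (p := p)
  have d₄ : PadicDvd p 2 (-4 * (B₄ - b₄) - p * B₄) := by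
    have e1 : PadicDvd p 2 ((p : ℚ) ^ 2 * B₄) := (PadicDvd.pow_self 2).mul_right i₄
    have e2 : PadicDvd p 2 ((p : ℚ) ^ 4 * ((p - 1) * b₄)) :=
      ((PadicDvd.pow_self 4).mono (by norm_num)).mul_right (ib₄.mul_left (h0.sub .one))
    exact ((k₄.sub e1).add e2).of_eq (by ring)
  have d₄' : PadicDvd p 1 (B₄ - b₄) := by
    refine .of_ofNat_mul 4 (by lia) ?_
    exact ((d₄.mono (m := 1) (by norm_num)).neg.sub (hself.mul_right i₄)).of_eq (by ring)
  have dγ : PadicDvd p 1 (5 * b₄ - 4 * γ) := by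
    have e1 : PadicDvd p 1 (p * ((p - 1) * γ)) := hself.mul_right (iγ.mul_left (h0.sub .one))
    exact (((hself.mul_right ib₄).sub kγ).sub e1).of_eq (by ring)
  refine .of_ofNat_mul 2 (by lia) ?_
  have e1 : PadicDvd p 2 (p * (B₄ - b₄)) := hself.mul d₄'
  have e2 : PadicDvd p 2 (p * (5 * b₄ - 4 * γ)) := hself.mul dγ
  exact (((d₄.mul_left (.ofNat 5)).neg.sub (e1.mul_left (.ofNat 5))).sub e2).of_eq (by ring)

/-- Reduction of the Bernoulli numbers attached to the two power sums of inverses. -/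
theorem padicDvd_choose_of_kummer (hp11 : 11 ≤ p) {C H₂ H₄ L B₂ B₄ B₆ b₂ b₄ γ : ℚ}
    (iL : PadicDvd p 0 L) (i₄ : PadicDvd p 0 B₄) (i₆ : PadicDvd p 0 B₆)
    (ib₂ : PadicDvd p 0 b₂) (ib₄ : PadicDvd p 0 b₄) (iγ : PadicDvd p 0 γ)
    (hH : PadicDvd p 2 H₂)
    (hC : PadicDvd p 7 (C - 1 + (p : ℚ) ^ 2 * H₂ + (p : ℚ) ^ 4 * H₄ / 2))
    (h₂ : PadicDvd p 5 (H₂ - p * B₂ - ((p : ℚ) ^ 5 - p ^ 4 - 2) *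
      ((p : ℚ) ^ 5 - p ^ 4 - 2 - 1) / 6 * (p : ℚ) ^ 3 * B₄))
    (h₄ : PadicDvd p 5 (H₄ - p * B₄ - L * (L - 1) / 6 * (p : ℚ) ^ 3 * B₆))
    (k₂ : PadicDvd p 4 (((p : ℚ) ^ 4 - p ^ 3 - 2) * B₂ - ((p : ℚ) ^ 5 - p ^ 4 - 2) * b₂))
    (k₄ : PadicDvd p 2 (((p : ℚ) ^ 2 - p - 4) * B₄ - ((p : ℚ) ^ 5 - p ^ 4 - 4) * b₄))
    (kγ : PadicDvd p 1 (((p : ℚ) - 5) * b₄ - ((p : ℚ) ^ 2 - p - 4) * γ)) :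
    PadicDvd p 7 (C - (1 - (p : ℚ) ^ 3 * b₂ - (3 / 2 : ℚ) * (p : ℚ) ^ 5 * b₄ +
      (3 / 10 : ℚ) * (p : ℚ) ^ 6 * γ)) := by
  have hpp (n : ℕ) : PadicDvd p n ((p : ℚ) ^ n) := .pow_self n
  have h0 := PadicDvd.natCast (p := p) p
  have i2 := padicDvd_inv_ofNat (p := p) 2 (by lia)
  have i6 := padicDvd_inv_ofNat (p := p) 6 (by lia)
  have i10 := padicDvd_inv_ofNat (p := p) 10 (by lia)
  have iM : PadicDvd p 0 ((p : ℚ) ^ 5 - p ^ 4 - 2) := ((h0.pow 5).sub (h0.pow 4)).sub (.ofNat 2)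
  have dV := padicDvd_sub_of_kummer_four hp11 i₄ ib₄ iγ k₄ kγ
  have e6 : PadicDvd p 7 ((p : ℚ) ^ 9 *
      (((p : ℚ) ^ 5 - p ^ 4 - 2 - 3) * (p - 1) * 6⁻¹ * B₄)) :=
    ((hpp 9).mono (by norm_num)).mul_right
      ((((iM.sub (.ofNat 3)).mul_right (h0.sub .one)).mul_right i6).mul_right i₄)
  have hB₂ : PadicDvd p 1 B₂ := by
    have e3 : PadicDvd p 2 ((p : ℚ) ^ 3 * (((p : ℚ) ^ 5 - p ^ 4 - 2) *
        ((p : ℚ) ^ 5 - p ^ 4 - 2 - 1) * 6⁻¹ * B₄)) :=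
      ((hpp 3).mono (by norm_num)).mul_right
        (((iM.mul_right (iM.sub .one)).mul_right i6).mul_right i₄)
    have e : PadicDvd p ((1 : ℕ) + 1) ((p : ℚ) ^ 1 * B₂) :=
      ((hH.sub (h₂.mono (by norm_num))).sub e3).of_eq (by ring)
    exact .of_pow_mul 1 e
  have d₂ := padicDvd_sub_of_kummer_two hp11 hB₂ ib₂ k₂
  have e1 : PadicDvd p 7 ((p : ℚ) ^ 2 * (H₂ - p * B₂ - ((p : ℚ) ^ 5 - p ^ 4 - 2) *
      ((p : ℚ) ^ 5 - p ^ 4 - 2 - 1) / 6 * (p : ℚ) ^ 3 * B₄)) := (hpp 2).mul h₂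
  have e2 : PadicDvd p 7 ((p : ℚ) ^ 4 * (H₄ - p * B₄ - L * (L - 1) / 6 * (p : ℚ) ^ 3 * B₆) *
      2⁻¹) :=
    (((hpp 4).mul h₄).mono (by norm_num)).mul_right i2
  have e3 : PadicDvd p 7 ((p : ℚ) ^ 7 * (L * (L - 1) * 6⁻¹ * 2⁻¹ * B₆)) :=
    (hpp 7).mul_right ((((iL.mul_right (iL.sub .one)).mul_right i6).mul_right i2).mul_right i₆)
  have e4 : PadicDvd p 7 ((p : ℚ) ^ 3 * (B₂ - b₂)) := (hpp 3).mul d₂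
  have e5 : PadicDvd p 7 ((p : ℚ) ^ 5 * (10 * (B₄ - b₄) + 2 * p * γ) * (3 * (10⁻¹ * 2⁻¹))) :=
    ((hpp 5).mul dV).mul_right ((i10.mul_right i2).mul_left (.ofNat 3))
  exact ((((((hC.sub e1).sub e2).sub e3).sub e4).sub e5).sub e6).of_eq (by ring)

end

theorem eleven_le_of_padicCong {p : ℕ} (hp : p.Prime)
    (hw : PadicCong p 4 ((Nat.choose (2 * p - 1) (p - 1)) : ℚ) 1) : 11 ≤ p := by
  have := Fact.mk hp
  have h : ((p ^ 4 : ℕ) : ℤ) ∣ ((2 * p - 1).choose (p - 1) : ℤ) - 1 := by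
    rw [padicNorm.dvd_iff_norm_le]
    simpa [PadicCong] using hw
  by_contra! hlt
  clear hw this
  interval_cases p <;> revert h hp <;> decide

theorem stmt17 (p : ℕ) (hp : p.Prime)
    (hw : PadicCong p 4 ((Nat.choose (2 * p - 1) (p - 1)) : ℚ) 1) :
    PadicCong p 7 ((Nat.choose (2 * p - 1) (p - 1)) : ℚ)
      (1 - (p : ℚ) ^ 3 * bernoulli (p ^ 4 - p ^ 3 - 2)
        - (3 / 2 : ℚ) * (p : ℚ) ^ 5 * bernoulli (p ^ 2 - p - 4)
        + (3 / 10 : ℚ) * (p : ℚ) ^ 6 * bernoulli (p - 5)) := by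
  have hp11 := eleven_le_of_padicCong hp hw
  have := Fact.mk hp
  rw [padicCong_iff_padicDvd] at hw ⊢
  obtain ⟨hH, hC⟩ := padicDvd_choose_sub_one_add hp11 hw
  obtain ⟨q, rfl⟩ : ∃ q, p = q + 1 := ⟨p - 1, by lia⟩
  have hq : 10 ≤ q := by lia
  have hqe : Even q := by simpa using hp.even_sub_one (by lia)
  have hpow (e : ℕ) (he : e ≠ 0) : 11 * q ≤ (q + 1) ^ e * q :=
    Nat.mul_le_mul_right _ (hp11.trans (Nat.le_self_pow he _))
  have hpow1 := hpow 1 (by norm_num)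
  have hpow3 := hpow 3 (by norm_num)
  have hpow4 := hpow 4 (by norm_num)
  obtain ⟨m, hm⟩ : ∃ m, m + 2 = (q + 1) ^ 3 * (q + 1 - 1) :=
    ⟨(q + 1) ^ 3 * q - 2, by rw [Nat.add_sub_cancel]; lia⟩
  obtain ⟨l, hl⟩ : ∃ l, l + 4 = (q + 1) ^ 1 * (q + 1 - 1) :=
    ⟨(q + 1) ^ 1 * q - 4, by rw [Nat.add_sub_cancel]; lia⟩
  obtain ⟨M, hM⟩ : ∃ M, M + 2 = (q + 1) ^ 4 * (q + 1 - 1) :=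
    ⟨(q + 1) ^ 4 * q - 2, by rw [Nat.add_sub_cancel]; lia⟩
  obtain ⟨L, rfl⟩ : ∃ L, M = L + 2 := ⟨M - 2, by lia⟩
  have hL : L + 4 = (q + 1) ^ 4 * (q + 1 - 1) := by lia
  obtain ⟨K, hK⟩ : ∃ K, L = K + 2 := ⟨L - 2, by lia⟩
  have hK6 : K + 6 = (q + 1) ^ 4 * (q + 1 - 1) := by lia
  have hr : (q - 4) + 4 = (q + 1) ^ 0 * (q + 1 - 1) := by
    rw [Nat.add_sub_cancel]
    lia
  have em : (q + 1) ^ 4 - (q + 1) ^ 3 - 2 = m := by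
    rw [Nat.add_sub_cancel] at hm
    have : (q + 1) ^ 4 = (q + 1) ^ 3 * q + (q + 1) ^ 3 := by ring
    lia
  have el : (q + 1) ^ 2 - (q + 1) - 4 = l := by
    rw [Nat.add_sub_cancel] at hl
    have : (q + 1) ^ 2 = (q + 1) ^ 1 * q + (q + 1) := by ring
    lia
  have er : q + 1 - 5 = q - 4 := by lia
  rw [em, el, er]
  have int {n k e : ℕ} (hk0 : 0 < k) (hk : k < 10) (hke : Even k) (hn : 4 ≤ n)
      (h : n + k = (q + 1) ^ e * (q + 1 - 1)) : PadicDvd (q + 1) 0 (bernoulli n) :=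
    padicDvd_bernoulli_zero hp11 hn (even_of_add_eq hp11 hke h)
      (not_sub_one_dvd hk0 (by lia) h)
  have kum {N n k e : ℕ} (t : ℕ) (hN : 1 ≤ N) (hn : 4 ≤ n) (hNn : N + 1 ≤ n) (hk0 : 0 < k)
      (hk : k < 10) (hke : Even k) (h : n + k = (q + 1) ^ e * (q + 1 - 1)) :=
    padicDvd_kummer hp11 hN hn hNn (even_of_add_eq hp11 hke h) (not_sub_one_dvd hk0 (by lia) h) t
  have k2 := kum (N := 4) q (by norm_num) (by lia) (by lia) (by norm_num) (by norm_num)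
    (by decide) hm
  have k4 := kum (N := 2) (q * ((q + 1) ^ 2 + (q + 1) + 1)) (by norm_num) (by lia) (by lia)
    (by norm_num) (by norm_num) (by decide) hl
  have kg := kum (N := 1) q (by norm_num) (by lia) (by lia) (by norm_num) (by norm_num)
    (by decide) hr
  rw [show m + (q + 1) ^ (4 - 1) * (q + 1 - 1) * q = L + 2 by
    rw [Nat.add_sub_cancel] at *
    apply Nat.add_right_cancel (m := 2)
    rw [hM, add_right_comm, hm]
    ring] at k2
  rw [show l + (q + 1) ^ (2 - 1) * (q + 1 - 1) * (q * ((q + 1) ^ 2 + (q + 1) + 1)) = L by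
    rw [Nat.add_sub_cancel] at *
    apply Nat.add_right_cancel (m := 4)
    rw [hL, add_right_comm, hl]
    ring] at k4
  rw [show q - 4 + (q + 1) ^ (1 - 1) * (q + 1 - 1) * q = l by
    rw [Nat.add_sub_cancel] at *
    apply Nat.add_right_cancel (m := 4)
    rw [hl, add_right_comm, hr]
    ring] at kg
  have h2 := padicDvd_invPowSum_sub_bernoulli hp11 (by norm_num) (by decide) hM
  have h4 := padicDvd_invPowSum_sub_bernoulli hp11 (by norm_num) (by decide) hL
  rw [Nat.add_sub_cancel] at h2
  rw [hK, Nat.add_sub_cancel, ← hK] at h4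
  have cm : (m : ℚ) = ((q + 1 : ℕ) : ℚ) ^ 4 - ((q + 1 : ℕ) : ℚ) ^ 3 - 2 := by
    rw [Nat.add_sub_cancel] at hm
    have : (m : ℚ) + 2 = (q + 1) ^ 3 * q := by exact_mod_cast hm
    push_cast
    linear_combination this
  have cl : (l : ℚ) = ((q + 1 : ℕ) : ℚ) ^ 2 - ((q + 1 : ℕ) : ℚ) - 4 := by
    rw [Nat.add_sub_cancel] at hl
    have : (l : ℚ) + 4 = (q + 1) ^ 1 * q := by exact_mod_cast hl
    push_cast
    linear_combination this
  have cL : (L : ℚ) = ((q + 1 : ℕ) : ℚ) ^ 5 - ((q + 1 : ℕ) : ℚ) ^ 4 - 4 := by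
    rw [Nat.add_sub_cancel] at hL
    have : (L : ℚ) + 4 = (q + 1) ^ 4 * q := by exact_mod_cast hL
    push_cast
    linear_combination this
  have cM : ((L + 2 : ℕ) : ℚ) = ((q + 1 : ℕ) : ℚ) ^ 5 - ((q + 1 : ℕ) : ℚ) ^ 4 - 2 := by
    rw [Nat.cast_add, cL]
    push_cast
    ring
  have cr : ((q - 4 : ℕ) : ℚ) = ((q + 1 : ℕ) : ℚ) - 5 := by
    rw [Nat.cast_sub (by lia)]
    push_cast
    ring
  rw [cm, cM] at k2
  rw [cl, cL] at k4
  rw [cr, cl] at kg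
  rw [cM] at h2
  exact padicDvd_choose_of_kummer hp11 (.natCast L)
    (int (by norm_num) (by norm_num) (by decide) (by lia) hL)
    (int (by norm_num) (by norm_num) (by decide) (by lia) hK6)
    (int (by norm_num) (by norm_num) (by decide) (by lia) hm)
    (int (by norm_num) (by norm_num) (by decide) (by lia) hl)
    (int (by norm_num) (by norm_num) (by decide) (by lia) hr)
    hH hC h2 h4 k2 k4 kg
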